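/- arXiv:1811.03862 — 3 statements merged into one kernel-verified Lean document; each statement's English description precedes it below -/
import Mathlib

section
/- Let Y_1 and Y_2 be independent integrable real-valued random variables on a probability space, let R ∈ ℝ², and let y ∈ ℝ² satisfy y_1 < R_1 and y_2 > R_2. Assume P( (R_1 − Y_1)_+ < R_1 − y_1 ) > 0 and E[(R_2 − Y_2)_+] > 0. Then E[ max( (R_1 − y_1)_+, (R_1 − Y_1)_+ ) ] · E[ max( (R_2 − y_2)_+, (R_2 − Y_2)_+ ) ] = E[ max( R_1 − y_1, (R_1 − Y_1)_+ ) ] · E[ (R_2 − Y_2)_+ ] > E[ (R_1 − Y_1)_+ (R_2 − Y_2)_+ ]. -/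
open MeasureTheory ProbabilityTheory

/-- The paper's claim that mq-EI evaluated at one training point `y` (with `y₁ < R₁` and
`y₂ > R₂`) and one new point, modeled by independent integrable random variables `Y₁, Y₂`,
strictly exceeds mEI at the new point, provided `P((R₁ − Y₁)₊ < R₁ − y₁) > 0` and
`E[(R₂ − Y₂)₊] > 0`:
`E[max((R₁ − y₁)₊, (R₁ − Y₁)₊)] ⬝ E[max((R₂ − y₂)₊, (R₂ − Y₂)₊)]
  = E[max(R₁ − y₁, (R₁ − Y₁)₊)] ⬝ E[(R₂ − Y₂)₊] > E[(R₁ − Y₁)₊ (R₂ − Y₂)₊]`. -/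
theorem mqEI_training_new_point_gt_mEI {Ω : Type*} [MeasurableSpace Ω] (μ : Measure Ω)
    [IsProbabilityMeasure μ] (Y₁ Y₂ : Ω → ℝ)
    (hint₁ : Integrable Y₁ μ) (hint₂ : Integrable Y₂ μ)
    (hindep : IndepFun Y₁ Y₂ μ)
    (R₁ R₂ y₁ y₂ : ℝ) (hy₁ : y₁ < R₁) (hy₂ : R₂ < y₂)
    (hpos : 0 < μ {ω | max (R₁ - Y₁ ω) 0 < R₁ - y₁})
    (hEI₂ : 0 < ∫ ω, max (R₂ - Y₂ ω) 0 ∂μ) :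
    ((∫ ω, max (max (R₁ - y₁) 0) (max (R₁ - Y₁ ω) 0) ∂μ)
        * (∫ ω, max (max (R₂ - y₂) 0) (max (R₂ - Y₂ ω) 0) ∂μ)
      = (∫ ω, max (R₁ - y₁) (max (R₁ - Y₁ ω) 0) ∂μ) * (∫ ω, max (R₂ - Y₂ ω) 0 ∂μ))
    ∧ ((∫ ω, max (R₁ - y₁) (max (R₁ - Y₁ ω) 0) ∂μ) * (∫ ω, max (R₂ - Y₂ ω) 0 ∂μ)
      > ∫ ω, (max (R₁ - Y₁ ω) 0) * (max (R₂ - Y₂ ω) 0) ∂μ) := by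
  have hplus₁ : Integrable (fun ω ↦ max (R₁ - Y₁ ω) 0) μ :=
    ((integrable_const R₁).sub hint₁).pos_part
  have hmax : Integrable (fun ω ↦ max (R₁ - y₁) (max (R₁ - Y₁ ω) 0)) μ :=
    (integrable_const (R₁ - y₁)).sup hplus₁
  have hfactor : ∫ ω, max (R₁ - Y₁ ω) 0 * max (R₂ - Y₂ ω) 0 ∂μ =
      (∫ ω, max (R₁ - Y₁ ω) 0 ∂μ) * ∫ ω, max (R₂ - Y₂ ω) 0 ∂μ := by
    have hmeas (R : ℝ) : Measurable fun t : ℝ ↦ max (R - t) 0 := by fun_prop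
    exact (hindep.comp (hmeas R₁) (hmeas R₂)).integral_fun_mul_eq_mul_integral
      hplus₁.aestronglyMeasurable
      ((integrable_const R₂).sub hint₂).pos_part.aestronglyMeasurable
  have hlt : ∫ ω, max (R₁ - Y₁ ω) 0 ∂μ < ∫ ω, max (R₁ - y₁) (max (R₁ - Y₁ ω) 0) ∂μ := by
    rw [← sub_pos, ← integral_sub hmax hplus₁,
      integral_pos_iff_support_of_nonneg (fun ω ↦ sub_nonneg.2 (le_max_right _ _))
        (hmax.sub hplus₁)]
    refine hpos.trans_le (measure_mono fun ω hω ↦ ?_)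
    exact (sub_pos.2 (lt_max_of_lt_left hω)).ne'
  refine ⟨?_, hfactor ▸ mul_lt_mul_of_pos_right hlt hEI₂⟩
  simp_rw [max_eq_left (sub_pos.2 hy₁).le, max_eq_right (sub_neg.2 hy₂).le,
    max_eq_right (le_max_right _ (0 : ℝ))]
end

section
/- Let R ∈ ℝ^m, let P ⊆ ℝ^m be a finite set such that no point p ∈ P dominates R (i.e., for every p ∈ P there exists j with p_j > R_j), and let y ∈ ℝ^m. Then the hypervolume improvement of y over P up to R equals the product of the coordinatewise improvements: H(P ∪ {y}; R) − H(P; R) = ∏_{j=1}^m (R_j − y_j)_+. -/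
/-- The dominated hypervolume of a set `A` up to the reference point `R`:
the Lebesgue measure of the union of the order boxes `[y, R]`, `y ∈ A`. -/
noncomputable def hypervol {m : ℕ} (A : Set (Fin m → ℝ)) (R : Fin m → ℝ) : ℝ :=
  (MeasureTheory.volume (⋃ y ∈ A, Set.Icc y R)).toReal

/-- If no point of the finite set `P` dominates the reference point `R`, then for any
`y ∈ ℝ^m` the hypervolume improvement of `y` over `P` up to `R` equals the product of the
coordinatewise improvements: `H(P ∪ {y}; R) − H(P; R) = ∏ⱼ (Rⱼ − yⱼ)₊`. -/
theorem hypervolume_improvement_eq_prod {m : ℕ} (R : Fin m → ℝ) (P : Finset (Fin m → ℝ))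
    (hP : ∀ p ∈ P, ∃ j, R j < p j) (y : Fin m → ℝ) :
    hypervol (insert y (P : Set (Fin m → ℝ))) R - hypervol (P : Set (Fin m → ℝ)) R
      = ∏ j, max (R j - y j) 0 := by
  have hempty : (⋃ p ∈ (P : Set (Fin m → ℝ)), Set.Icc p R) = ∅ := by
    simp only [Set.iUnion_eq_empty]
    intro p hp
    obtain ⟨j, hj⟩ := hP p hp
    exact Set.Icc_eq_empty fun h => (h j).not_gt hj
  simp only [hypervol, Set.biUnion_insert, hempty, Set.union_empty, MeasureTheory.measure_empty,
    ENNReal.toReal_zero, sub_zero, Real.volume_Icc_pi, ENNReal.toReal_prod,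
    ENNReal.toReal_ofReal']
end

section
/- Let A ⊆ ℝ^m be a nonempty finite set, let P be its Pareto front (the set of its minimal elements), let I and N be the Ideal and Nadir points of P (componentwise minimum and maximum over P), and suppose the point C ∈ P lies on the segment joining I and N. Let g : ℝ^m → ℝ^m be given coordinatewise by g(y)_j = a_j y_j + b_j with a_j > 0 for all j. Then g(C) belongs to the Pareto front of g(A) and lies on the segment joining the Ideal and Nadir points of the Pareto front of g(A); i.e., the center of the Pareto front is invariant under positive coordinatewise affine rescaling of the objectives when the Pareto front intersects the Ideal–Nadir line. -/
/-- `u` Pareto-dominates `v` if `uⱼ ≤ vⱼ` for all `j` and `uⱼ < vⱼ` for some `j`. -/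
def Dominates {m : ℕ} (u v : Fin m → ℝ) : Prop :=
  (∀ j, u j ≤ v j) ∧ ∃ j, u j < v j

open Classical in
/-- The Pareto front of a finite set `A`: the points of `A` not Pareto-dominated by any
point of `A`. -/
noncomputable def paretoFrontF {m : ℕ} (A : Finset (Fin m → ℝ)) : Finset (Fin m → ℝ) :=
  A.filter (fun y => ∀ u ∈ A, ¬ Dominates u y)

/-- The Ideal point of a nonempty finite Pareto front: coordinatewise minimum. -/
noncomputable def idealPt {m : ℕ} (P : Finset (Fin m → ℝ)) (h : P.Nonempty) : Fin m → ℝ :=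
  fun j => P.inf' h (fun y => y j)

/-- The Nadir point of a nonempty finite Pareto front: coordinatewise maximum. -/
noncomputable def nadirPt {m : ℕ} (P : Finset (Fin m → ℝ)) (h : P.Nonempty) : Fin m → ℝ :=
  fun j => P.sup' h (fun y => y j)

theorem dominates_rescale_iff {m : ℕ} {a : Fin m → ℝ} (ha : ∀ j, 0 < a j)
    (b u v : Fin m → ℝ) :
    Dominates (fun j => a j * u j + b j) (fun j => a j * v j + b j) ↔ Dominates u v := by
  simp only [Dominates, add_le_add_iff_right, add_lt_add_iff_right,
    mul_le_mul_iff_right₀ (ha _), mul_lt_mul_iff_right₀ (ha _)]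

open Classical in
theorem paretoFrontF_image_rescale {m : ℕ} {a : Fin m → ℝ} (ha : ∀ j, 0 < a j)
    (b : Fin m → ℝ) (A : Finset (Fin m → ℝ)) :
    paretoFrontF (A.image (fun y (j : Fin m) => a j * y j + b j)) =
      (paretoFrontF A).image (fun y (j : Fin m) => a j * y j + b j) := by
  simp only [paretoFrontF, Finset.filter_image, Finset.forall_mem_image,
    dominates_rescale_iff ha]

theorem monotone_mul_add_const {c : ℝ} (hc : 0 < c) (d : ℝ) :
    Monotone (fun x : ℝ => c * x + d) :=
  fun _ _ h => by dsimp only; gcongr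

open Classical in
theorem idealPt_image_rescale {m : ℕ} {a : Fin m → ℝ} (ha : ∀ j, 0 < a j)
    (b : Fin m → ℝ) (P : Finset (Fin m → ℝ)) (h : P.Nonempty)
    (h' : (P.image (fun y (j : Fin m) => a j * y j + b j)).Nonempty) :
    idealPt (P.image (fun y (j : Fin m) => a j * y j + b j)) h' =
      fun j => a j * idealPt P h j + b j := by
  funext j
  rw [idealPt, Finset.inf'_image]
  exact (Finset.apply_inf'_eq_inf'_comp h (fun x => a j * x + b j)
    (fun _ _ => (monotone_mul_add_const (ha j) (b j)).map_min)).symm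

open Classical in
theorem nadirPt_image_rescale {m : ℕ} {a : Fin m → ℝ} (ha : ∀ j, 0 < a j)
    (b : Fin m → ℝ) (P : Finset (Fin m → ℝ)) (h : P.Nonempty)
    (h' : (P.image (fun y (j : Fin m) => a j * y j + b j)).Nonempty) :
    nadirPt (P.image (fun y (j : Fin m) => a j * y j + b j)) h' =
      fun j => a j * nadirPt P h j + b j := by
  funext j
  rw [nadirPt, Finset.sup'_image]
  exact (Finset.apply_sup'_eq_sup'_comp h (fun x => a j * x + b j)
    (fun _ _ => (monotone_mul_add_const (ha j) (b j)).map_max)).symm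

theorem rescale_mem_segment {m : ℕ} (a b : Fin m → ℝ) {x y z : Fin m → ℝ}
    (h : z ∈ segment ℝ x y) :
    (fun j => a j * z j + b j) ∈
      segment ℝ (fun j => a j * x j + b j) (fun j => a j * y j + b j) := by
  obtain ⟨s, t, hs, ht, hst, rfl⟩ := h
  refine ⟨s, t, hs, ht, hst, ?_⟩
  funext j
  simp only [Pi.add_apply, Pi.smul_apply, smul_eq_mul]
  linear_combination b j * hst

open Classical in
/-- The center of the Pareto front is invariant under a positive coordinatewise affine
rescaling of the objectives: if `A ⊆ ℝ^m` is a nonempty finite set whose Pareto front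
contains a point `C` lying on the segment joining the Ideal and Nadir points of the
Pareto front, and `g(y)ⱼ = aⱼ yⱼ + bⱼ` with `aⱼ > 0`, then `g(C)` belongs to the Pareto
front of `g(A)` and lies on the segment joining the Ideal and Nadir points of the Pareto
front of `g(A)`. Here `B = g(A)` denotes the image of `A` under the rescaling `g`. -/
theorem pareto_center_affine_invariant {m : ℕ} (A : Finset (Fin m → ℝ)) (hA : A.Nonempty)
    (C : Fin m → ℝ) (hC : C ∈ paretoFrontF A)
    (hseg : C ∈ segment ℝ (idealPt (paretoFrontF A) ⟨C, hC⟩)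
      (nadirPt (paretoFrontF A) ⟨C, hC⟩))
    (a b : Fin m → ℝ) (ha : ∀ j, 0 < a j)
    (B : Finset (Fin m → ℝ))
    (hB : B = A.image (fun y (j : Fin m) => a j * y j + b j)) :
    ∃ h' : (paretoFrontF B).Nonempty,
      (fun j => a j * C j + b j) ∈ paretoFrontF B
      ∧ (fun j => a j * C j + b j) ∈ segment ℝ
          (idealPt (paretoFrontF B) h') (nadirPt (paretoFrontF B) h') := by
  subst hB
  rw [paretoFrontF_image_rescale ha b A]
  have hmem := Finset.mem_image_of_mem (fun y (j : Fin m) => a j * y j + b j) hC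
  refine ⟨Finset.Nonempty.image ⟨C, hC⟩ _, hmem, ?_⟩
  rw [idealPt_image_rescale ha b _ ⟨C, hC⟩, nadirPt_image_rescale ha b _ ⟨C, hC⟩]
  exact rescale_mem_segment a b hseg
end
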